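/- arXiv:1604.02305 — 8 statements merged into one kernel-verified Lean document; each statement's English description precedes it below -/
import Mathlib

section
/- Let a be a positive integer and b, m, n nonnegative integers with m ≤ n. Then A(b,a;n,m) ∈ ℤ[q] if and only if A(b,a;n+la, m+ka) ∈ ℤ[q] for all integers k, l such that 0 ≤ m+ka ≤ n+la. -/
open Polynomial Finset

/-- `A(b,a;n,m) ∈ ℤ[q]`: the polynomial `(1-q^a)·∏_{i=1}^m (1-q^i)·∏_{i=1}^{n-m} (1-q^i)`
divides `(1-q^b)·∏_{i=1}^n (1-q^i)` in `ℤ[q]`. -/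
def AIsPoly (b a n m : ℕ) : Prop :=
  ((1 - X ^ a) * (∏ i ∈ range m, (1 - X ^ (i + 1))) *
      ∏ i ∈ range (n - m), (1 - X ^ (i + 1)) : Polynomial ℤ) ∣
    (1 - X ^ b) * ∏ i ∈ range n, (1 - X ^ (i + 1))

theorem Prime.pow_le_of_prod_pow_dvd {ι M : Type*} [CommMonoidWithZero M] [IsCancelMulZero M]
    [DecidableEq ι] {s : Finset ι} {p : ι → M} (hp : ∀ i ∈ s, Prime (p i))
    (hne : ∀ i ∈ s, ∀ j ∈ s, p i ∣ p j → i = j) {e f : ι → ℕ}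
    (h : ∏ i ∈ s, p i ^ e i ∣ ∏ i ∈ s, p i ^ f i) {i : ι} (hi : i ∈ s) : e i ≤ f i := by
  have h1 : p i ^ e i ∣ p i ^ f i * ∏ j ∈ s.erase i, p j ^ f j := by
    rw [Finset.mul_prod_erase s (fun j => p j ^ f j) hi]
    exact (Finset.dvd_prod_of_mem (fun j => p j ^ e j) hi).trans h
  have h2 : ¬ p i ∣ ∏ j ∈ s.erase i, p j ^ f j := by
    intro hd
    obtain ⟨j, hj, hjd⟩ := (hp i hi).exists_mem_finset_dvd hd
    rw [Finset.mem_erase] at hj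
    exact hj.1 (hne i hi j hj.2 ((hp i hi).dvd_of_dvd_pow hjd)).symm
  exact (pow_dvd_pow_iff (hp i hi).ne_zero (hp i hi).not_isUnit).1
    ((hp i hi).pow_dvd_of_dvd_mul_right _ h2 h1)

theorem cyclotomic_int_prime {d : ℕ} (hd : 0 < d) : Prime (cyclotomic d ℤ) :=
  (cyclotomic.irreducible hd).prime

theorem eq_of_cyclotomic_int_dvd {d e : ℕ} (hd : 0 < d) (he : 0 < e)
    (h : cyclotomic d ℤ ∣ cyclotomic e ℤ) : d = e :=
  cyclotomic_injective (eq_of_monic_of_associated (cyclotomic.monic d ℤ) (cyclotomic.monic e ℤ)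
    ((cyclotomic.irreducible hd).associated_of_dvd (cyclotomic.irreducible he) h))

theorem one_sub_X_pow_eq_prod_cyclotomic {k N : ℕ} (hk : 0 < k) (hN : k ≤ N) :
    (1 - X ^ k : ℤ[X]) = -1 * ∏ d ∈ Icc 1 N, cyclotomic d ℤ ^ (if d ∣ k then 1 else 0) := by
  have h : ∏ d ∈ Icc 1 N, cyclotomic d ℤ ^ (if d ∣ k then 1 else 0) = X ^ k - 1 := by
    rw [← prod_cyclotomic_eq_X_pow_sub_one hk ℤ]
    simp only [pow_ite, pow_one, pow_zero]
    rw [← Finset.prod_filter]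
    refine Finset.prod_congr ?_ fun _ _ => rfl
    ext d
    simp only [mem_filter, mem_Icc, Nat.mem_divisors]
    constructor
    · rintro ⟨-, h⟩
      exact ⟨h, hk.ne'⟩
    · rintro ⟨h, -⟩
      exact ⟨⟨Nat.pos_of_dvd_of_pos h hk, (Nat.le_of_dvd hk h).trans hN⟩, h⟩
  rw [h]
  ring

theorem prod_one_sub_X_pow_eq_prod_cyclotomic {n N : ℕ} (hN : n ≤ N) :
    (∏ i ∈ range n, (1 - X ^ (i + 1)) : ℤ[X]) =
      (-1) ^ n * ∏ d ∈ Icc 1 N, cyclotomic d ℤ ^ (n / d) := by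
  induction n with
  | zero => simp
  | succ n ih =>
    rw [Finset.prod_range_succ, ih (by omega),
      one_sub_X_pow_eq_prod_cyclotomic (Nat.succ_pos n) hN]
    simp only [Nat.succ_div, pow_add, Finset.prod_mul_distrib]
    ring

theorem Nat.div_add_div_sub {m n d : ℕ} (hmn : m ≤ n) (hd : 0 < d) :
    n / d = m / d + (n - m) / d + if n % d < m % d then 1 else 0 := by
  obtain ⟨k, rfl⟩ := Nat.exists_eq_add_of_le hmn
  have hm := Nat.mod_lt m hd
  have hk := Nat.mod_lt k hd
  rw [Nat.add_sub_cancel_left, Nat.add_div hd, Nat.add_mod]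
  congr 1
  by_cases h : d ≤ m % d + k % d
  · rw [if_pos h, Nat.mod_eq_sub_mod h, Nat.mod_eq_of_lt (a := _ - d) (by omega),
      if_pos (by omega)]
  · rw [if_neg h, Nat.mod_eq_of_lt (by omega), if_neg (by omega)]

theorem aIsPoly_iff {a b m n : ℕ} (ha : 0 < a) (hb : 0 < b) (hmn : m ≤ n) :
    AIsPoly b a n m ↔ ∀ d, d ∣ a → ¬ d ∣ b → n % d < m % d := by
  obtain ⟨N, haN, hbN, hnN⟩ : ∃ N, a ≤ N ∧ b ≤ N ∧ n ≤ N :=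
    ⟨a + b + n, by omega, by omega, by omega⟩
  have hden : ((1 - X ^ a) * (∏ i ∈ range m, (1 - X ^ (i + 1))) *
      ∏ i ∈ range (n - m), (1 - X ^ (i + 1)) : ℤ[X]) = (-1) ^ (n + 1) *
        ∏ d ∈ Icc 1 N, cyclotomic d ℤ ^ ((if d ∣ a then 1 else 0) + m / d + (n - m) / d) := by
    rw [one_sub_X_pow_eq_prod_cyclotomic ha haN,
      prod_one_sub_X_pow_eq_prod_cyclotomic (hmn.trans hnN),
      prod_one_sub_X_pow_eq_prod_cyclotomic ((Nat.sub_le n m).trans hnN)]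
    have hs : ((-1) ^ (n + 1) : ℤ[X]) = -1 * (-1) ^ m * (-1) ^ (n - m) := by
      rw [mul_assoc, ← pow_add, Nat.add_sub_cancel' hmn, pow_succ']
    simp only [pow_add _ (_ + _), pow_add _ (ite _ _ _), Finset.prod_mul_distrib]
    rw [hs]
    ring
  have hnum : ((1 - X ^ b) * ∏ i ∈ range n, (1 - X ^ (i + 1)) : ℤ[X]) = (-1) ^ (n + 1) *
        ∏ d ∈ Icc 1 N, cyclotomic d ℤ ^ ((if d ∣ b then 1 else 0) + n / d) := by
    rw [one_sub_X_pow_eq_prod_cyclotomic hb hbN, prod_one_sub_X_pow_eq_prod_cyclotomic hnN]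
    simp only [pow_add, Finset.prod_mul_distrib]
    ring
  rw [AIsPoly, hden, hnum, mul_dvd_mul_iff_left (by simp)]
  constructor
  · intro h d hda hdb
    have hd : 0 < d := Nat.pos_of_dvd_of_pos hda ha
    have hle := Prime.pow_le_of_prod_pow_dvd
      (fun i hi => cyclotomic_int_prime (mem_Icc.1 hi).1)
      (fun i hi j hj => eq_of_cyclotomic_int_dvd (mem_Icc.1 hi).1 (mem_Icc.1 hj).1) h
      (mem_Icc.2 ⟨hd, (Nat.le_of_dvd ha hda).trans haN⟩)
    rw [if_pos hda, if_neg hdb, Nat.div_add_div_sub hmn hd] at hle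
    by_contra hlt
    rw [if_neg hlt] at hle
    omega
  · intro h
    refine Finset.prod_dvd_prod_of_dvd _ _ fun d hd => pow_dvd_pow _ ?_
    rw [Nat.div_add_div_sub hmn (mem_Icc.1 hd).1]
    have := h d
    split_ifs <;> omega

theorem Int.toNat_add_mul_mod {n a d : ℕ} {l : ℤ} (hd : d ∣ a) (h : 0 ≤ (n : ℤ) + l * a) :
    ((n : ℤ) + l * a).toNat % d = n % d := by
  obtain ⟨c, rfl⟩ := hd
  rw [← Nat.cast_inj (R := ℤ), Int.natCast_mod, Int.natCast_mod]
  rw [Int.toNat_of_nonneg h, Nat.cast_mul, mul_left_comm, Int.add_mul_emod_self_left]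

theorem stmt0 (a : ℕ) (b m n : ℕ) (ha : 0 < a) (hmn : m ≤ n) :
    AIsPoly b a n m ↔
      ∀ k l : ℤ, 0 ≤ (m : ℤ) + k * a → (m : ℤ) + k * a ≤ (n : ℤ) + l * a →
        AIsPoly b a ((n : ℤ) + l * a).toNat ((m : ℤ) + k * a).toNat := by
  constructor
  · intro h k l hk hkl
    obtain rfl | hb := Nat.eq_zero_or_pos b
    · simp [AIsPoly]
    rw [aIsPoly_iff ha hb hmn] at h
    rw [aIsPoly_iff ha hb (Int.toNat_le_toNat hkl)]
    intro d hda hdb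
    rw [Int.toNat_add_mul_mod hda hk, Int.toNat_add_mul_mod hda (hk.trans hkl)]
    exact h d hda hdb
  · intro h
    simpa using h 0 0 (by simp) (by simpa using hmn)
end

section
/- Let a, b, m, n be nonnegative integers with a > 0 and na ≥ m. Then A(b,a;na,m) ∈ ℤ[q] if and only if gcd(a,m) divides b. -/
open Polynomial Finset

/-- The product `(1-q)(1-q²)⋯(1-q^(i+j))` is divisible by the products of lengths `i` and `j`. -/
lemma prod_one_sub_X_pow_mul_dvd (R : Type*) [CommRing R] (i j : ℕ) :
    ((∏ k ∈ range i, (1 - X ^ (k + 1))) * ∏ k ∈ range j, (1 - X ^ (k + 1)) : R[X]) ∣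
      ∏ k ∈ range (i + j), (1 - X ^ (k + 1)) := by
  induction i generalizing j with
  | zero => simp
  | succ i ihi =>
    induction j with
    | zero => simp
    | succ j ihj =>
      have hi := mul_dvd_mul_right (ihi (j + 1)) (1 - X ^ (i + 1))
      have hj := mul_dvd_mul_right ihj (1 - X ^ (j + 1))
      rw [show i + 1 + j = i + (j + 1) by ring] at hj
      rw [show i + 1 + (j + 1) = i + (j + 1) + 1 by ring, prod_range_succ _ (i + (j + 1))]
      simp only [prod_range_succ _ i, prod_range_succ _ j] at hi hj ⊢
      rw [mul_right_comm] at hi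
      rw [mul_assoc] at hj
      convert! dvd_add hi (hj.mul_left (X ^ (i + 1))) using 1
      ring

/-- If `D` divides `(1 - q^k) N` and `(1 - q^l) N`, then it divides `(1 - q^gcd(k,l)) N`. -/
lemma dvd_one_sub_X_pow_gcd_mul {R : Type*} [CommRing R] {D N : R[X]} (k l : ℕ)
    (hk : D ∣ (1 - X ^ k) * N) (hl : D ∣ (1 - X ^ l) * N) :
    D ∣ (1 - X ^ Nat.gcd k l) * N := by
  induction k, l using Nat.gcd.induction with
  | H0 l => simpa using hl
  | H1 k l _ ih =>
    rw [Nat.gcd_rec]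
    refine ih ?_ hk
    have hq : (1 - X ^ k : R[X]) ∣ 1 - X ^ (k * (l / k)) := by
      simpa [pow_mul] using sub_dvd_pow_sub_pow (1 : R[X]) (X ^ k) (l / k)
    have hkl : D ∣ (1 - X ^ (k * (l / k))) * N := hk.trans (mul_dvd_mul_right hq N)
    have hsub := dvd_sub hl (hkl.mul_left (X ^ (l % k)))
    have hX : (X ^ l : R[X]) = X ^ (l % k) * X ^ (k * (l / k)) := by
      rw [← pow_add, Nat.mod_add_div]
    convert! hsub using 1
    rw [hX]
    ring

lemma X_sub_C_dvd_one_sub_X_pow_iff {ζ : ℂ} {g : ℕ} (hζ : IsPrimitiveRoot ζ g) (j : ℕ) :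
    (X - C ζ ∣ (1 - X ^ j : ℂ[X])) ↔ g ∣ j := by
  rw [dvd_iff_isRoot, ← hζ.pow_eq_one_iff_dvd]
  simp [sub_eq_zero, eq_comm (a := (1 : ℂ))]

lemma emultiplicity_X_sub_C_one_sub_X_pow {ζ : ℂ} {g : ℕ} (hζ : IsPrimitiveRoot ζ g) {j : ℕ}
    (hj : j ≠ 0) :
    emultiplicity (X - C ζ) (1 - X ^ j : ℂ[X]) = if g ∣ j then 1 else 0 := by
  split_ifs with h
  · refine (emultiplicity_eq_coe (n := 1)).2
      ⟨by simpa using (X_sub_C_dvd_one_sub_X_pow_iff hζ j).2 h, fun hsq => ?_⟩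
    have hsep : (X ^ j - 1 : ℂ[X]).Separable :=
      X_pow_sub_one_separable_iff.2 (Nat.cast_ne_zero.2 hj)
    refine (prime_X_sub_C ζ).not_isUnit (hsep.squarefree _ ?_)
    rw [← dvd_neg, neg_sub]
    simpa [pow_two] using hsq
  · exact emultiplicity_eq_zero.2 fun hd => h ((X_sub_C_dvd_one_sub_X_pow_iff hζ j).1 hd)

lemma emultiplicity_X_sub_C_prod_one_sub_X_pow {ζ : ℂ} {g : ℕ} (hζ : IsPrimitiveRoot ζ g)
    (k : ℕ) :
    emultiplicity (X - C ζ) (∏ i ∈ range k, (1 - X ^ (i + 1)) : ℂ[X]) = (k / g : ℕ) := by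
  induction k with
  | zero =>
    simpa using emultiplicity_eq_zero.2
      fun h => (prime_X_sub_C ζ).not_isUnit (isUnit_of_dvd_one h)
  | succ k ih =>
    rw [prod_range_succ, emultiplicity_mul (prime_X_sub_C ζ), ih,
      emultiplicity_X_sub_C_one_sub_X_pow hζ k.succ_ne_zero, Nat.succ_div]
    split_ifs <;> simp

theorem stmt2 (a b m n : ℕ) (ha : 0 < a) (hm : m ≤ n * a) :
    AIsPoly b a (n * a) m ↔ Nat.gcd a m ∣ b := by
  unfold AIsPoly
  constructor
  · intro h
    by_contra hb
    have hg : Nat.gcd a m ≠ 0 := (Nat.gcd_pos_of_pos_left m ha).ne'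
    have hb0 : b ≠ 0 := by
      rintro rfl
      exact hb (dvd_zero _)
    have hζ := Complex.isPrimitiveRoot_exp (Nat.gcd a m) hg
    have hmap := map_dvd (mapRingHom (Int.castRingHom ℂ)) h
    simp only [map_mul, map_sub, map_one, map_pow, map_prod, coe_mapRingHom, map_X] at hmap
    have hle := emultiplicity_le_emultiplicity_of_dvd_right
      (a := X - C (Complex.exp (2 * Real.pi * Complex.I / (Nat.gcd a m : ℕ)))) hmap
    simp only [emultiplicity_mul (prime_X_sub_C _),
      emultiplicity_X_sub_C_prod_one_sub_X_pow hζ,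
      emultiplicity_X_sub_C_one_sub_X_pow hζ ha.ne',
      emultiplicity_X_sub_C_one_sub_X_pow hζ hb0, Nat.gcd_dvd_left, if_true, hb, if_false] at hle
    have hnat : 1 + m / Nat.gcd a m + (n * a - m) / Nat.gcd a m ≤ 0 + n * a / Nat.gcd a m := by
      exact_mod_cast hle
    have hsplit := Nat.add_div_of_dvd_right (b := n * a - m) (Nat.gcd_dvd_right a m)
    rw [Nat.add_sub_cancel' hm] at hsplit
    omega
  · rintro ⟨c, rfl⟩
    have hgc : (1 - X ^ Nat.gcd a m : ℤ[X]) ∣ 1 - X ^ (Nat.gcd a m * c) := by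
      simpa [pow_mul] using sub_dvd_pow_sub_pow (1 : ℤ[X]) (X ^ Nat.gcd a m) c
    refine (dvd_one_sub_X_pow_gcd_mul a m ?_ ?_).trans (mul_dvd_mul_right hgc _)
    · rw [mul_assoc]
      refine mul_dvd_mul_left _ ?_
      simpa [Nat.add_sub_cancel' hm] using prod_one_sub_X_pow_mul_dvd ℤ m (n * a - m)
    · rcases m with _ | m
      · simp
      · obtain ⟨d, hd⟩ := Nat.exists_eq_add_of_le hm
        have hna : (1 - X ^ a : ℤ[X]) ∣ 1 - X ^ (m + d + 1) := by
          rw [show m + d + 1 = a * n by linarith]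
          simpa [pow_mul] using sub_dvd_pow_sub_pow (1 : ℤ[X]) (X ^ a) n
        have hmul := mul_dvd_mul_left (1 - X ^ (m + 1))
          (mul_dvd_mul (prod_one_sub_X_pow_mul_dvd ℤ m d) hna)
        rw [hd, Nat.add_sub_cancel_left, prod_range_succ _ m,
          show m + 1 + d = m + d + 1 by ring, prod_range_succ _ (m + d)]
        convert! hmul using 1
        ring
end

section
/- Let a, b, m, n be nonnegative integers with a > 0, b ≤ a and na ≥ m. Then A(b,a;na,m) ∈ ℕ₀[q] if and only if gcd(a,m) divides b. -/
open Polynomial Finset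

/-- `A(b,a;n,m) ∈ ℕ₀[q]`: the polynomial `(1-q^a)·∏_{i=1}^m (1-q^i)·∏_{i=1}^{n-m} (1-q^i)`
divides `(1-q^b)·∏_{i=1}^n (1-q^i)` in `ℤ[q]` and the quotient has nonnegative coefficients. -/
def AIsNatPoly (b a n m : ℕ) : Prop :=
  ∃ c : Polynomial ℤ,
    ((1 - X ^ b) * ∏ i ∈ range n, (1 - X ^ (i + 1)) : Polynomial ℤ) =
      ((1 - X ^ a) * (∏ i ∈ range m, (1 - X ^ (i + 1))) *
        ∏ i ∈ range (n - m), (1 - X ^ (i + 1))) * c ∧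
    ∀ k : ℕ, 0 ≤ c.coeff k

/-! ### Raising and lowering operators on functions of finite sets -/

/-- Exchange the roles of `i` and `i + 1` in a finite set. -/
def swapSucc (i : ℕ) : Finset ℕ ≃ Finset ℕ := (Equiv.swap i (i + 1)).finsetCongr

theorem mem_swapSucc {i x : ℕ} {S : Finset ℕ} :
    x ∈ swapSucc i S ↔ Equiv.swap i (i + 1) x ∈ S := by
  simp [swapSucc, Finset.mem_map_equiv]

theorem swapSucc_swapSucc (i : ℕ) (S : Finset ℕ) : swapSucc i (swapSucc i S) = S := by
  ext x; simp [mem_swapSucc]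

theorem swapSucc_mem_powersetCard {L m i : ℕ} (hi : i < L) {S : Finset ℕ} :
    swapSucc i S ∈ powersetCard m (range (L + 1)) ↔ S ∈ powersetCard m (range (L + 1)) := by
  have key : ∀ S : Finset ℕ, S ∈ powersetCard m (range (L + 1)) →
      swapSucc i S ∈ powersetCard m (range (L + 1)) := by
    intro S hS
    rw [mem_powersetCard] at hS ⊢
    refine ⟨fun x hx => ?_, by simpa [swapSucc] using hS.2⟩
    have := mem_range.1 (hS.1 (mem_swapSucc.1 hx))
    rw [mem_range]
    rcases eq_or_ne x i with rfl | h1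
    · omega
    rcases eq_or_ne x (i + 1) with rfl | h2
    · omega
    rwa [Equiv.swap_apply_of_ne_of_ne h1 h2] at this
  exact ⟨fun h => swapSucc_swapSucc i S ▸ key _ h, key S⟩

theorem sum_swapSucc {i : ℕ} {S : Finset ℕ} (h1 : i + 1 ∈ S) (h2 : i ∉ S) :
    ∑ x ∈ swapSucc i S, x + 1 = ∑ x ∈ S, x := by
  have h : swapSucc i S = insert i (S.erase (i + 1)) := by
    ext x
    rw [mem_swapSucc, mem_insert, mem_erase]
    rcases eq_or_ne x i with rfl | hi
    · simp [h1]
    rcases eq_or_ne x (i + 1) with rfl | hi'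
    · simp [h2]
    · simp [Equiv.swap_apply_of_ne_of_ne hi hi', hi, hi']
  rw [h, sum_insert (by simp [h2]), ← add_sum_erase S (fun x => x) h1]
  ring

theorem sum_swapSucc_powersetCard {L m i : ℕ} (hi : i < L) (f : Finset ℕ → ℝ) :
    ∑ S ∈ powersetCard m (range (L + 1)), f (swapSucc i S) =
      ∑ S ∈ powersetCard m (range (L + 1)), f S :=
  sum_equiv (swapSucc i) (fun _ => (swapSucc_mem_powersetCard hi).symm) fun _ _ => rfl

/-- The operator dual to moving an element `i` of a set up to `i + 1`, with weights `w`. -/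
noncomputable def raiseOp (w : ℕ → ℝ) (L : ℕ) (v : Finset ℕ → ℝ) (T : Finset ℕ) : ℝ :=
  ∑ i ∈ range L, if i + 1 ∈ T ∧ i ∉ T then w i * v (swapSucc i T) else 0

/-- The adjoint of `raiseOp`. -/
noncomputable def lowerOp (w : ℕ → ℝ) (L : ℕ) (v : Finset ℕ → ℝ) (S : Finset ℕ) : ℝ :=
  ∑ i ∈ range L, if i ∈ S ∧ i + 1 ∉ S then w i * v (swapSucc i S) else 0

theorem sum_raise_mul_raise_eq {L m i j : ℕ} (hi : i < L) (hj : j < L) (hij : i ≠ j)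
    (w : ℕ → ℝ) (v : Finset ℕ → ℝ) :
    ∑ T ∈ powersetCard m (range (L + 1)),
      (if i + 1 ∈ T ∧ i ∉ T then w i * v (swapSucc i T) else 0) *
        (if j + 1 ∈ T ∧ j ∉ T then w j * v (swapSucc j T) else 0) =
    ∑ T ∈ powersetCard m (range (L + 1)),
      (if i ∈ T ∧ i + 1 ∉ T then w i * v (swapSucc i T) else 0) *
        (if j ∈ T ∧ j + 1 ∉ T then w j * v (swapSucc j T) else 0) := by
  rcases eq_or_ne j (i + 1) with rfl | h1
  · refine sum_congr rfl fun T _ => ?_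
    split_ifs <;> first | (exfalso; tauto) | simp
  rcases eq_or_ne i (j + 1) with rfl | h2
  · refine sum_congr rfl fun T _ => ?_
    split_ifs <;> first | (exfalso; tauto) | simp
  conv_rhs => rw [← sum_swapSucc_powersetCard hi, ← sum_swapSucc_powersetCard hj]
  refine sum_congr rfl fun T _ => ?_
  have hcomm : swapSucc j (swapSucc i (swapSucc j T)) = swapSucc i T := by
    ext x
    simp only [mem_swapSucc, Equiv.swap_apply_def]
    grind
  have e1 : Equiv.swap j (j + 1) i = i := Equiv.swap_apply_of_ne_of_ne hij h2
  have e2 : Equiv.swap j (j + 1) (i + 1) = i + 1 :=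
    Equiv.swap_apply_of_ne_of_ne (Ne.symm h1) (by omega)
  have e3 : Equiv.swap i (i + 1) j = j := Equiv.swap_apply_of_ne_of_ne hij.symm h1
  have e4 : Equiv.swap i (i + 1) (j + 1) = j + 1 :=
    Equiv.swap_apply_of_ne_of_ne (Ne.symm h2) (by omega)
  simp only [mem_swapSucc, swapSucc_swapSucc, hcomm, e1, e2, e3, e4, Equiv.swap_apply_left,
    Equiv.swap_apply_right]
  split_ifs <;> ring

theorem sum_raise_mul_raise_self {L m i : ℕ} (hi : i < L) (w : ℕ → ℝ) (v : Finset ℕ → ℝ) :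
    ∑ T ∈ powersetCard m (range (L + 1)),
      (if i + 1 ∈ T ∧ i ∉ T then w i * v (swapSucc i T) else 0) *
        (if i + 1 ∈ T ∧ i ∉ T then w i * v (swapSucc i T) else 0) =
    ∑ T ∈ powersetCard m (range (L + 1)),
      (if i ∈ T ∧ i + 1 ∉ T then w i * v (swapSucc i T) else 0) *
        (if i ∈ T ∧ i + 1 ∉ T then w i * v (swapSucc i T) else 0) +
    ∑ T ∈ powersetCard m (range (L + 1)),
      v T ^ 2 * (w i ^ 2 * ((if i ∈ T then 1 else 0) - (if i + 1 ∈ T then 1 else 0))) := by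
  conv_lhs => rw [← sum_swapSucc_powersetCard hi]
  conv_rhs => enter [1]; rw [← sum_swapSucc_powersetCard hi]
  rw [← sum_add_distrib]
  refine sum_congr rfl fun T _ => ?_
  simp only [mem_swapSucc, swapSucc_swapSucc, Equiv.swap_apply_left, Equiv.swap_apply_right]
  split_ifs <;> first | (exfalso; tauto) | ring

theorem sum_raiseOp_sq (L m : ℕ) (w : ℕ → ℝ) (v : Finset ℕ → ℝ) :
    ∑ T ∈ powersetCard m (range (L + 1)), raiseOp w L v T ^ 2 =
    ∑ T ∈ powersetCard m (range (L + 1)), lowerOp w L v T ^ 2 +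
    ∑ T ∈ powersetCard m (range (L + 1)), v T ^ 2 * ∑ i ∈ range L,
      w i ^ 2 * ((if i ∈ T then 1 else 0) - (if i + 1 ∈ T then 1 else 0)) := by
  have expand : ∀ g : ℕ → Finset ℕ → ℝ,
      ∑ T ∈ powersetCard m (range (L + 1)), (∑ i ∈ range L, g i T) ^ 2 =
      ∑ i ∈ range L, ∑ j ∈ range L, ∑ T ∈ powersetCard m (range (L + 1)), g i T * g j T := by
    intro g
    simp only [sq, sum_mul_sum]
    rw [sum_comm]
    exact sum_congr rfl fun i _ => sum_comm
  simp only [raiseOp, lowerOp, expand, mul_sum]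
  rw [sum_comm (s := powersetCard m (range (L + 1))), ← sum_add_distrib]
  refine sum_congr rfl fun i hi => ?_
  rw [← add_sum_erase _ _ hi, ← add_sum_erase _ _ hi,
    sum_raise_mul_raise_self (mem_range.1 hi), add_right_comm]
  congr 2
  refine sum_congr rfl fun j hj => ?_
  rw [mem_erase] at hj
  exact sum_raise_mul_raise_eq (mem_range.1 hi) (mem_range.1 hj.2) hj.1.symm w v

theorem sum_weight_sub {L m : ℕ} {S : Finset ℕ} (hS : S ∈ powersetCard m (range (L + 1))) :
    ∑ i ∈ range L, √(((i : ℝ) + 1) * (L - i)) ^ 2 *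
      ((if i ∈ S then 1 else 0) - (if i + 1 ∈ S then 1 else 0)) =
    (m : ℝ) * L - 2 * (∑ x ∈ S, x : ℕ) := by
  have h1 : ∑ i ∈ range L, √(((i : ℝ) + 1) * (L - i)) ^ 2 *
      ((if i ∈ S then 1 else 0) - (if i + 1 ∈ S then 1 else 0)) =
      ∑ i ∈ range L, ((i : ℝ) + 1) * (L - i) * (if i ∈ S then 1 else 0) -
      ∑ i ∈ range L, ((i : ℝ) + 1) * (L - i) * (if i + 1 ∈ S then 1 else 0) := by
    rw [← sum_sub_distrib]
    refine sum_congr rfl fun i hi => ?_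
    have : (i : ℝ) ≤ L := by exact_mod_cast (mem_range.1 hi).le
    rw [Real.sq_sqrt (mul_nonneg (by positivity) (by linarith))]
    ring
  have h2 : ∑ i ∈ range L, ((i : ℝ) + 1) * (L - i) * (if i ∈ S then 1 else 0) =
      ∑ i ∈ range (L + 1), ((i : ℝ) + 1) * (L - i) * (if i ∈ S then 1 else 0) := by
    rw [sum_range_succ]; simp
  have h3 : ∑ i ∈ range L, ((i : ℝ) + 1) * (L - i) * (if i + 1 ∈ S then 1 else 0) =
      ∑ i ∈ range (L + 1), (i : ℝ) * (L + 1 - i) * (if i ∈ S then 1 else 0) := by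
    rw [sum_range_succ']
    simp
  rw [mem_powersetCard] at hS
  have h4 : ∀ g : ℕ → ℝ,
      ∑ i ∈ range (L + 1), g i * (if i ∈ S then 1 else 0) = ∑ i ∈ S, g i := by
    intro g
    simp only [mul_ite, mul_one, mul_zero]
    rw [← sum_filter, filter_mem_eq_inter, inter_eq_right.2 hS.1]
  rw [h1, h2, h3, h4, h4, ← sum_sub_distrib]
  push_cast
  rw [← hS.2, mul_sum, card_eq_sum_ones]
  push_cast
  rw [sum_mul, ← sum_sub_distrib]
  exact sum_congr rfl fun i _ => by ring

/-- The `m`-element subsets of `{0, …, M - 1}` whose elements add up to `s`. -/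
def subsetsWithSum (M m s : ℕ) : Finset (Finset ℕ) :=
  {S ∈ powersetCard m (range M) | ∑ x ∈ S, x = s}

theorem eq_zero_of_raiseOp_eq_zero {L m s : ℕ} (hs : 2 * s < m * L) (v : Finset ℕ → ℝ)
    (hv : ∀ S ∉ subsetsWithSum (L + 1) m s, v S = 0)
    (h : ∀ T ∈ subsetsWithSum (L + 1) m (s + 1),
      raiseOp (fun i => √(((i : ℝ) + 1) * (L - i))) L v T = 0) :
    v = 0 := by
  have hraise : ∀ T ∈ powersetCard m (range (L + 1)),
      raiseOp (fun i => √(((i : ℝ) + 1) * (L - i))) L v T = 0 := by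
    intro T hT
    by_cases hsum : ∑ x ∈ T, x = s + 1
    · exact h T (mem_filter.2 ⟨hT, hsum⟩)
    · refine sum_eq_zero fun i hi => ?_
      split_ifs with hc
      · have := sum_swapSucc hc.1 hc.2
        rw [hv, mul_zero]
        intro hmem
        have := (mem_filter.1 hmem).2
        omega
      · rfl
  have hsq := sum_raiseOp_sq L m (fun i => √(((i : ℝ) + 1) * (L - i))) v
  rw [sum_eq_zero fun T hT => by rw [hraise T hT, sq, mul_zero]] at hsq
  have hpos : (0 : ℝ) < m * L - 2 * s := by
    rw [sub_pos]; exact_mod_cast hs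
  have hweight : ∑ T ∈ powersetCard m (range (L + 1)), v T ^ 2 * ∑ i ∈ range L,
      √(((i : ℝ) + 1) * (L - i)) ^ 2 *
        ((if i ∈ T then 1 else 0) - (if i + 1 ∈ T then 1 else 0)) =
      ∑ T ∈ powersetCard m (range (L + 1)), v T ^ 2 * ((m : ℝ) * L - 2 * s) := by
    refine sum_congr rfl fun T hT => ?_
    by_cases hsum : ∑ x ∈ T, x = s
    · rw [sum_weight_sub hT, hsum]
    · rw [hv T fun hmem => hsum (mem_filter.1 hmem).2]; simp
  rw [hweight] at hsq
  have hlow : 0 ≤ ∑ T ∈ powersetCard m (range (L + 1)),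
      lowerOp (fun i => √(((i : ℝ) + 1) * (L - i))) L v T ^ 2 :=
    sum_nonneg fun _ _ => sq_nonneg _
  have hterm : ∀ T ∈ powersetCard m (range (L + 1)), 0 ≤ v T ^ 2 * ((m : ℝ) * L - 2 * s) :=
    fun _ _ => mul_nonneg (sq_nonneg _) hpos.le
  have hzero := (sum_eq_zero_iff_of_nonneg hterm).1
    (le_antisymm (by linarith) (sum_nonneg hterm))
  funext S
  by_cases hS : S ∈ subsetsWithSum (L + 1) m s
  · simpa [hpos.ne'] using hzero S (mem_filter.1 hS).1
  · exact hv S hS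

theorem card_subsetsWithSum_le_succ {L m s : ℕ} (hs : 2 * s < m * L) :
    #(subsetsWithSum (L + 1) m s) ≤ #(subsetsWithSum (L + 1) m (s + 1)) := by
  let extend : (subsetsWithSum (L + 1) m s → ℝ) → Finset ℕ → ℝ :=
    fun v S => if h : S ∈ subsetsWithSum (L + 1) m s then v ⟨S, h⟩ else 0
  let f : (subsetsWithSum (L + 1) m s → ℝ) →ₗ[ℝ] (subsetsWithSum (L + 1) m (s + 1) → ℝ) :=
    { toFun := fun v T => raiseOp (fun i => √(((i : ℝ) + 1) * (L - i))) L (extend v) T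
      map_add' := by
        intro v v'
        funext T
        simp only [raiseOp, Pi.add_apply, ← sum_add_distrib, extend]
        refine sum_congr rfl fun i _ => ?_
        split_ifs <;> ring
      map_smul' := by
        intro r v
        funext T
        simp only [raiseOp, Pi.smul_apply, smul_eq_mul, mul_sum, extend, RingHom.id_apply]
        refine sum_congr rfl fun i _ => ?_
        split_ifs <;> ring }
  have hf : Function.Injective f := by
    rw [← LinearMap.ker_eq_bot, LinearMap.ker_eq_bot']
    intro v hv
    have h0 := eq_zero_of_raiseOp_eq_zero hs (extend v) (fun S hS => dif_neg hS)
      (fun T hT => congrFun hv ⟨T, hT⟩)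
    funext S
    simpa [extend] using congrFun h0 S
  simpa using LinearMap.finrank_le_finrank_of_injective hf

theorem card_subsetsWithSum_symm {L m s : ℕ} (hs : s ≤ m * L) :
    #(subsetsWithSum (L + 1) m s) = #(subsetsWithSum (L + 1) m (m * L - s)) := by
  have hinv : ∀ S ⊆ range (L + 1), (S.image (L - ·)).image (L - ·) = S := by
    intro S hS
    rw [image_image]
    refine (image_congr fun x hx => ?_).trans image_id
    have := mem_range.1 (hS hx)
    simp only [Function.comp, id]
    omega
  have hmap : ∀ t ≤ m * L, ∀ S ∈ subsetsWithSum (L + 1) m t,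
      S.image (L - ·) ∈ subsetsWithSum (L + 1) m (m * L - t) := by
    intro t ht S hS
    simp only [subsetsWithSum, mem_filter, mem_powersetCard] at hS ⊢
    obtain ⟨⟨hsub, hcard⟩, hsum⟩ := hS
    have hinj : Set.InjOn (L - ·) (S : Set ℕ) := by
      intro x hx y hy hxy
      have := mem_range.1 (hsub hx)
      have := mem_range.1 (hsub hy)
      simp only at hxy
      omega
    refine ⟨⟨fun x hx => ?_, by rw [card_image_of_injOn hinj, hcard]⟩, ?_⟩
    · obtain ⟨y, -, rfl⟩ := mem_image.1 hx
      exact mem_range.2 (by omega)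
    · rw [sum_image hinj]
      have : ∑ x ∈ S, (L - x) + ∑ x ∈ S, x = m * L := by
        rw [← sum_add_distrib, ← hcard, ← smul_eq_mul, ← sum_const]
        refine sum_congr rfl fun x hx => ?_
        have := mem_range.1 (hsub hx)
        omega
      omega
  refine card_bij' (fun S _ => S.image (L - ·)) (fun S _ => S.image (L - ·))
    (hmap s hs) (fun S hS => ?_) (fun S hS => ?_) (fun S hS => ?_)
  · simpa [Nat.sub_sub_self hs] using hmap _ (Nat.sub_le _ _) S hS
  · exact hinv S (mem_powersetCard.1 (mem_filter.1 hS).1).1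
  · exact hinv S (mem_powersetCard.1 (mem_filter.1 hS).1).1

theorem card_subsetsWithSum_eq_zero {L m s : ℕ} (hs : m * L < s) :
    #(subsetsWithSum (L + 1) m s) = 0 := by
  rw [card_eq_zero, subsetsWithSum, filter_eq_empty_iff]
  intro S hS hsum
  rw [mem_powersetCard] at hS
  have := sum_le_card_nsmul S (fun x => x) L fun x hx => by
    have := mem_range.1 (hS.1 hx)
    omega
  rw [hS.2, smul_eq_mul] at this
  omega

theorem card_subsetsWithSum_le {L m s t : ℕ} (hst : s ≤ t) (h : s + t ≤ m * L) :
    #(subsetsWithSum (L + 1) m s) ≤ #(subsetsWithSum (L + 1) m t) := by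
  have mono : ∀ t, s ≤ t → 2 * t ≤ m * L + 1 →
      #(subsetsWithSum (L + 1) m s) ≤ #(subsetsWithSum (L + 1) m t) := by
    intro t hst
    induction t, hst using Nat.le_induction with
    | base => exact fun _ => le_rfl
    | succ t _ ih => exact fun h => (ih (by omega)).trans (card_subsetsWithSum_le_succ (by omega))
  by_cases ht : 2 * t ≤ m * L
  · exact mono t hst (by omega)
  · rw [card_subsetsWithSum_symm (s := t) (by omega)]
    exact mono _ (by omega) (by omega)

theorem card_subsetsWithSum_ge {L m s t : ℕ} (hst : s ≤ t) (h : m * L ≤ s + t) :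
    #(subsetsWithSum (L + 1) m t) ≤ #(subsetsWithSum (L + 1) m s) := by
  by_cases ht : t ≤ m * L
  · rw [card_subsetsWithSum_symm ht, card_subsetsWithSum_symm (hst.trans ht)]
    exact card_subsetsWithSum_le (by omega) (by omega)
  · rw [card_subsetsWithSum_eq_zero (by omega)]
    exact Nat.zero_le _

/-! ### The generating function of subsets by sum -/

/-- The generating function of the `m`-element subsets of `{0, …, M - 1}` by the sum of their
elements; it is `X ^ (m.choose 2)` times a Gaussian binomial coefficient. -/
noncomputable def subsetSumPoly (M m : ℕ) : ℤ[X] :=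
  ∑ S ∈ powersetCard m (range M), X ^ ∑ x ∈ S, x

theorem coeff_subsetSumPoly (M m s : ℕ) :
    (subsetSumPoly M m).coeff s = #(subsetsWithSum M m s) := by
  simp [subsetSumPoly, finsetSum_coeff, coeff_X_pow, subsetsWithSum, eq_comm]

theorem subsetSumPoly_succ (M m : ℕ) :
    subsetSumPoly (M + 1) (m + 1) = subsetSumPoly M (m + 1) + X ^ M * subsetSumPoly M m := by
  have hM : ∀ S ∈ powersetCard m (range M), M ∉ S := fun S hS hMS => by
    simpa using (mem_powersetCard.1 hS).1 hMS
  rw [subsetSumPoly, range_add_one, powersetCard_succ_insert notMem_range_self, sum_union,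
    sum_image, subsetSumPoly, subsetSumPoly, mul_sum]
  · congr 1
    refine sum_congr rfl fun S hS => ?_
    rw [sum_insert (hM S hS), pow_add]
  · intro S hS T hT hST
    rw [← erase_insert (hM S hS), ← erase_insert (hM T hT)]
    exact congrArg (fun U => U.erase M) hST
  · rw [disjoint_left]
    intro S hS hS'
    obtain ⟨T, -, rfl⟩ := mem_image.1 hS'
    simpa using (mem_powersetCard.1 hS).1 (mem_insert_self M T)

theorem subsetSumPoly_mul_prod (m k : ℕ) :
    subsetSumPoly (m + k) m * (∏ i ∈ range m, (1 - X ^ (i + 1))) *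
      ∏ i ∈ range k, (1 - X ^ (i + 1)) =
    X ^ m.choose 2 * ∏ i ∈ range (m + k), (1 - X ^ (i + 1)) := by
  induction hN : m + k generalizing m k with
  | zero =>
    obtain ⟨rfl, rfl⟩ : m = 0 ∧ k = 0 := by omega
    simp [subsetSumPoly]
  | succ N ih =>
    rcases m with _ | m
    · obtain rfl : k = N + 1 := by omega
      simp [subsetSumPoly]
    rcases k with _ | k
    · obtain rfl : m = N := by omega
      have : powersetCard (m + 1) (range (m + 1)) = {range (m + 1)} := by
        simpa using powersetCard_self (range (m + 1))
      simp [subsetSumPoly, this, sum_range_id, Nat.choose_two_right]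
    · have h1 := ih (m + 1) k (by omega)
      have h2 := ih m (k + 1) (by omega)
      obtain rfl : N = m + (k + 1) := by omega
      rw [prod_range_succ _ k] at h2 ⊢
      rw [prod_range_succ _ m] at h1 ⊢
      rw [subsetSumPoly_succ, prod_range_succ _ (m + (k + 1))]
      rw [Nat.choose_succ_succ' m 1, Nat.choose_one_right] at h1 ⊢
      linear_combination (1 - X ^ (k + 1)) * h1 + X ^ (m + (k + 1)) * (1 - X ^ (m + 1)) * h2

theorem one_sub_X_pow_ne_zero {R : Type*} [CommRing R] [Nontrivial R] {n : ℕ} (hn : n ≠ 0) :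
    (1 - X ^ n : R[X]) ≠ 0 := by
  intro h
  simpa [hn, coeff_one] using congrArg (coeff · n) h

theorem prod_one_sub_X_pow_ne_zero {R : Type*} [CommRing R] [IsDomain R] (n : ℕ) :
    (∏ i ∈ range n, (1 - X ^ (i + 1)) : R[X]) ≠ 0 :=
  prod_ne_zero_iff.2 fun i _ => one_sub_X_pow_ne_zero i.succ_ne_zero

theorem one_sub_X_pow_mul_subsetSumPoly (m k : ℕ) :
    (1 - X ^ (m + 1)) * subsetSumPoly (m + 1 + k) (m + 1) =
      X ^ m * (1 - X ^ (m + 1 + k)) * subsetSumPoly (m + k) m := by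
  have h1 := subsetSumPoly_mul_prod (m + 1) k
  have h2 := subsetSumPoly_mul_prod m k
  apply mul_right_cancel₀ (mul_ne_zero (prod_one_sub_X_pow_ne_zero (R := ℤ) m)
    (prod_one_sub_X_pow_ne_zero k))
  rw [show m + 1 + k = m + k + 1 by omega] at h1 ⊢
  rw [prod_range_succ _ m, prod_range_succ _ (m + k), Nat.choose_succ_succ' m 1,
    Nat.choose_one_right] at h1
  linear_combination h1 - X ^ m * (1 - X ^ (m + k + 1)) * h2

/-! ### Divisibility -/

theorem one_sub_pow_dvd_one_sub_pow {R : Type*} [CommRing R] (x : R) {m n : ℕ} (h : m ∣ n) :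
    1 - x ^ m ∣ 1 - x ^ n := by
  obtain ⟨k, rfl⟩ := h
  simpa [pow_mul] using sub_dvd_pow_sub_pow 1 (x ^ m) k

theorem dvd_one_sub_pow_gcd_mul {R : Type*} [CommRing R] {x D G : R} (a m : ℕ)
    (ha : D ∣ (1 - x ^ a) * G) (hm : D ∣ (1 - x ^ m) * G) :
    D ∣ (1 - x ^ Nat.gcd a m) * G := by
  induction a, m using Nat.gcd.induction with
  | H0 m => simpa using hm
  | H1 a m _ ih =>
    rw [Nat.gcd_rec]
    refine ih ?_ ha
    have h1 : D ∣ (1 - x ^ (a * (m / a))) * G :=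
      ha.trans (mul_dvd_mul_right (one_sub_pow_dvd_one_sub_pow x (dvd_mul_right _ _)) G)
    have h2 : (1 - x ^ (m % a)) * G =
        (1 - x ^ m) * G - x ^ (m % a) * ((1 - x ^ (a * (m / a))) * G) := by
      conv_rhs => enter [1]; rw [← Nat.mod_add_div m a, pow_add]
      ring
    rw [h2]
    exact dvd_sub hm (h1.mul_left _)

theorem one_sub_X_pow_dvd {a b m N : ℕ} (haN : a ∣ N) (hm : m ≤ N) (hb : Nat.gcd a m ∣ b) :
    (1 - X ^ a : ℤ[X]) ∣ (1 - X ^ b) * subsetSumPoly N m := by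
  refine dvd_trans ?_ (mul_dvd_mul_right (one_sub_pow_dvd_one_sub_pow X hb) _)
  refine dvd_one_sub_pow_gcd_mul a m (dvd_mul_right _ _) ?_
  rcases m with _ | m
  · simp
  obtain ⟨k, rfl⟩ := Nat.exists_eq_add_of_le hm
  rw [one_sub_X_pow_mul_subsetSumPoly]
  exact ((one_sub_pow_dvd_one_sub_pow X haN).mul_left _).mul_right _

/-! ### Nonnegativity of the quotient -/

theorem coeff_one_sub_X_pow_mul (a : ℕ) (p : ℤ[X]) (j : ℕ) :
    ((1 - X ^ a) * p).coeff j = p.coeff j - if a ≤ j then p.coeff (j - a) else 0 := by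
  rw [sub_mul, one_mul, coeff_sub, coeff_X_pow_mul']

theorem coeff_nonneg_of_mul_eq {L m a b : ℕ} (ha : 0 < a) (hba : b ≤ a) {C : ℤ[X]}
    (hC : (1 - X ^ b) * subsetSumPoly (L + 1) m = (1 - X ^ a) * C) (j : ℕ) :
    0 ≤ C.coeff j := by
  have hcoeff : ∀ j, C.coeff j - (if a ≤ j then C.coeff (j - a) else 0) =
      (#(subsetsWithSum (L + 1) m j) : ℤ) -
        if b ≤ j then (#(subsetsWithSum (L + 1) m (j - b)) : ℤ) else 0 := by
    intro j
    rw [← coeff_one_sub_X_pow_mul, ← hC, coeff_one_sub_X_pow_mul]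
    simp only [coeff_subsetSumPoly]
  by_cases hj : 2 * j ≤ m * L + b
  · induction j using Nat.strong_induction_on with
    | _ j ih =>
      have hstep : 0 ≤ (#(subsetsWithSum (L + 1) m j) : ℤ) -
          if b ≤ j then (#(subsetsWithSum (L + 1) m (j - b)) : ℤ) else 0 := by
        split_ifs with hbj
        · exact sub_nonneg.2 (Nat.cast_le.2 (card_subsetsWithSum_le (by omega) (by omega)))
        · simp
      rw [← hcoeff] at hstep
      split_ifs at hstep with haj
      · linarith [ih (j - a) (by omega) (by omega)]
      · simpa using hstep
  · have hdesc : ∀ n j, m * L + b < 2 * j → C.natDegree < j + n → 0 ≤ C.coeff j := by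
      intro n
      induction n with
      | zero => exact fun j _ h => (coeff_eq_zero_of_natDegree_lt h).ge
      | succ n ih =>
        intro j h1 h2
        have h3 := ih (j + a) (by omega) (by omega)
        have h4 := hcoeff (j + a)
        rw [if_pos (by omega), if_pos (by omega), Nat.add_sub_cancel] at h4
        have h5 : (#(subsetsWithSum (L + 1) m (j + a)) : ℤ) ≤
            #(subsetsWithSum (L + 1) m (j + a - b)) :=
          Nat.cast_le.2 (card_subsetsWithSum_ge (by omega) (by omega))
        linarith
    exact hdesc (C.natDegree + 1) j (by omega) (by omega)

theorem aIsNatPoly_of_gcd_dvd {a b m N : ℕ} (ha : 0 < a) (hba : b ≤ a) (haN : a ∣ N) (hN : N ≠ 0)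
    (hm : m ≤ N) (hb : Nat.gcd a m ∣ b) : AIsNatPoly b a N m := by
  obtain ⟨C, hC⟩ := one_sub_X_pow_dvd haN hm hb
  have hprod := subsetSumPoly_mul_prod m (N - m)
  rw [Nat.add_sub_cancel' hm] at hprod
  set P : ℤ[X] := ∏ i ∈ range m, (1 - X ^ (i + 1)) with hP
  set Q : ℤ[X] := ∏ i ∈ range (N - m), (1 - X ^ (i + 1)) with hQ
  have hmul : X ^ m.choose 2 * ((1 - X ^ b) * ∏ i ∈ range N, (1 - X ^ (i + 1))) =
      ((1 - X ^ a) * P * Q) * C := by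
    linear_combination P * Q * hC - (1 - X ^ b) * hprod
  have hcop : ∀ n, 0 < n → IsCoprime (X : ℤ[X]) (1 - X ^ n) := fun n hn =>
    ⟨X ^ (n - 1), 1, by rw [← pow_succ, Nat.sub_add_cancel hn]; ring⟩
  have hcop' : IsCoprime (X ^ m.choose 2 : ℤ[X]) ((1 - X ^ a) * P * Q) :=
    (((hcop a ha).mul_right (IsCoprime.prod_right fun i _ => hcop _ i.succ_pos)).mul_right
      (IsCoprime.prod_right fun i _ => hcop _ i.succ_pos)).pow_left
  obtain ⟨c, rfl⟩ := hcop'.dvd_of_dvd_mul_left (Dvd.intro _ hmul)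
  refine ⟨c, ?_, fun k => ?_⟩
  · apply mul_left_cancel₀ (pow_ne_zero (m.choose 2) (X_ne_zero (R := ℤ)))
    rw [hmul]
    ring
  · obtain ⟨L, rfl⟩ := Nat.exists_eq_succ_of_ne_zero hN
    simpa [coeff_X_pow_mul] using coeff_nonneg_of_mul_eq ha hba hC (k + m.choose 2)

/-! ### Necessity of the divisibility condition -/

theorem rootMultiplicity_one_sub_X_pow {ζ : ℂ} {d n : ℕ} (hζ : IsPrimitiveRoot ζ d)
    (hn : n ≠ 0) :
    rootMultiplicity ζ (1 - X ^ n : ℂ[X]) = if d ∣ n then 1 else 0 := by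
  have hne := one_sub_X_pow_ne_zero (R := ℂ) hn
  split_ifs with h
  · refine le_antisymm ?_ ((rootMultiplicity_pos hne).2 ?_)
    · have hsep : (X ^ n - 1 : ℂ[X]).Separable :=
        separable_X_pow_sub_C 1 (by exact_mod_cast hn) one_ne_zero
      refine rootMultiplicity_le_one_of_separable ?_ ζ
      rw [← neg_sub]
      exact hsep.of_dvd (neg_dvd.2 dvd_rfl)
    · simp [IsRoot, (hζ.pow_eq_one_iff_dvd n).2 h]
  · refine rootMultiplicity_eq_zero fun hroot => h ?_
    rw [IsRoot, eval_sub, eval_one, eval_pow, eval_X, sub_eq_zero] at hroot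
    exact (hζ.pow_eq_one_iff_dvd n).1 hroot.symm

theorem rootMultiplicity_prod_one_sub_X_pow {ζ : ℂ} {d : ℕ} (hζ : IsPrimitiveRoot ζ d)
    (n : ℕ) :
    rootMultiplicity ζ (∏ i ∈ range n, (1 - X ^ (i + 1)) : ℂ[X]) = n / d := by
  induction n with
  | zero => simp
  | succ n ih =>
    have hne := prod_one_sub_X_pow_ne_zero (R := ℂ) (n + 1)
    rw [prod_range_succ] at hne ⊢
    rw [rootMultiplicity_mul hne, ih, rootMultiplicity_one_sub_X_pow hζ n.succ_ne_zero,
      Nat.succ_div]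

theorem dvd_of_aIsNatPoly {a b m N d : ℕ} (ha : 0 < a) (hda : d ∣ a) (hdm : d ∣ m)
    (hm : m ≤ N) (h : AIsNatPoly b a N m) : d ∣ b := by
  rcases eq_or_ne b 0 with rfl | hb
  · exact dvd_zero d
  obtain ⟨c, hc, -⟩ := h
  have hd : 0 < d := Nat.pos_of_dvd_of_pos hda ha
  have hζ := Complex.isPrimitiveRoot_exp d hd.ne'
  have hc' := congrArg (Polynomial.map (Int.castRingHom ℂ)) hc
  simp only [Polynomial.map_mul, Polynomial.map_sub, Polynomial.map_one, Polynomial.map_pow,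
    map_X, Polynomial.map_prod] at hc'
  have hne := mul_ne_zero (one_sub_X_pow_ne_zero (R := ℂ) hb) (prod_one_sub_X_pow_ne_zero N)
  have hroot := congrArg (rootMultiplicity (Complex.exp (2 * Real.pi * Complex.I / d))) hc'
  have hne' := hc' ▸ hne
  rw [rootMultiplicity_mul hne, rootMultiplicity_mul hne',
    rootMultiplicity_mul (left_ne_zero_of_mul hne'),
    rootMultiplicity_mul (left_ne_zero_of_mul (left_ne_zero_of_mul hne')),
    rootMultiplicity_one_sub_X_pow hζ hb, rootMultiplicity_one_sub_X_pow hζ ha.ne',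
    rootMultiplicity_prod_one_sub_X_pow hζ, rootMultiplicity_prod_one_sub_X_pow hζ,
    rootMultiplicity_prod_one_sub_X_pow hζ, if_pos hda] at hroot
  by_contra hdb
  have hdiv : m / d + (N - m) / d = N / d := by
    rw [← Nat.add_div_of_dvd_right hdm, Nat.add_sub_cancel' hm]
  rw [if_neg hdb] at hroot
  omega

theorem stmt3 (a b m n : ℕ) (ha : 0 < a) (hba : b ≤ a) (hm : m ≤ n * a) :
    AIsNatPoly b a (n * a) m ↔ Nat.gcd a m ∣ b := by
  refine ⟨dvd_of_aIsNatPoly ha (Nat.gcd_dvd_left a m) (Nat.gcd_dvd_right a m) hm,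
    fun h => ?_⟩
  rcases Nat.eq_zero_or_pos n with rfl | hn
  · obtain rfl : m = 0 := by omega
    rw [Nat.gcd_zero_right] at h
    rcases Nat.eq_zero_or_pos b with rfl | hb
    · exact ⟨0, by simp, by simp⟩
    · obtain rfl : b = a := le_antisymm hba (Nat.le_of_dvd hb h)
      exact ⟨1, by simp, fun k => by rw [coeff_one]; split_ifs <;> simp⟩
  · exact aIsNatPoly_of_gcd_dvd ha hba (dvd_mul_left a n) (by positivity) hm h
end

section
/- If a and n are nonnegative integers with a ≥ 3, then (a−1)n + 1 divides gcd( C((a−1)²n − 1, (a−1)n), C(a(a−1)n, 2(a−1)n + 1) ), where C(x,y) denotes the binomial coefficient 'x choose y'. -/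
theorem Nat.dvd_choose_of_dvd_succ_of_coprime {d N k : ℕ} (hd : d ∣ k + 1)
    (hc : Nat.Coprime d (N - k)) : d ∣ N.choose k := by
  refine hc.dvd_of_dvd_mul_right ?_
  rw [← Nat.choose_succ_right_eq]
  exact hd.mul_left _

theorem Nat.coprime_mul_add_one_of_add_eq_mul {b n c x : ℕ}
    (h : x + b = c * (b * n + 1)) : Nat.Coprime (b * n + 1) x := by
  have hb : Nat.Coprime (b * n + 1) b := by simp
  refine Nat.eq_one_of_dvd_coprimes hb (Nat.gcd_dvd_left _ x) ?_
  rw [← Nat.dvd_add_right (Nat.gcd_dvd_right (b * n + 1) x), h]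
  exact (Nat.gcd_dvd_left _ _).mul_left _

theorem stmt5 (a n : ℕ) (ha : 3 ≤ a) :
    ((a - 1) * n + 1) ∣
      Nat.gcd (Nat.choose ((a - 1) ^ 2 * n - 1) ((a - 1) * n))
        (Nat.choose (a * (a - 1) * n) (2 * (a - 1) * n + 1)) := by
  rcases Nat.eq_zero_or_pos n with rfl | hn
  · simp
  obtain ⟨c, rfl⟩ : ∃ c, a = c + 3 := ⟨a - 3, by omega⟩
  have hpos : 1 ≤ (c + 1) * ((c + 2) * n) := Nat.succ_le_of_lt (by positivity)
  have hcop : Nat.Coprime ((c + 2) * n + 1) ((c + 1) * ((c + 2) * n) - 1) := by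
    refine Nat.coprime_mul_add_one_of_add_eq_mul (c := c + 1) ?_
    rw [mul_add]
    omega
  rw [show c + 3 - 1 = c + 2 by omega]
  refine Nat.dvd_gcd (Nat.dvd_choose_of_dvd_succ_of_coprime dvd_rfl ?_)
    (Nat.dvd_choose_of_dvd_succ_of_coprime ⟨2, by ring⟩ ?_)
  · convert hcop using 1
    rw [show (c + 2) ^ 2 * n = (c + 1) * ((c + 2) * n) + (c + 2) * n by ring]
    omega
  · convert hcop using 1
    rw [show (c + 3) * (c + 2) * n = (c + 1) * ((c + 2) * n) + 2 * (c + 2) * n by ring]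
    omega
end

section
/- If a and n are nonnegative integers with a ≥ 3, then (a−1)n − 1 divides gcd( C((a−1)²n − 1, (a−1)n − 2), C(a(a−1)n − 2, 2(a−1)n − 3) ), where C(x,y) denotes the binomial coefficient 'x choose y'. -/
theorem dvd_choose_of_coprime_sub {m N k : ℕ} (hk : m ∣ k + 1) (h : m.Coprime (N - k)) :
    m ∣ N.choose k :=
  h.dvd_of_dvd_mul_right <| by
    rw [← Nat.choose_succ_right_eq]
    exact hk.mul_left _

theorem stmt6 (a n : ℕ) (ha : 3 ≤ a) :
    (((a : ℤ) - 1) * n - 1) ∣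
      (Nat.gcd (Nat.choose ((a - 1) ^ 2 * n - 1) ((a - 1) * n - 2))
        (Nat.choose (a * (a - 1) * n - 2) (2 * (a - 1) * n - 3)) : ℤ) := by
  rcases Nat.eq_zero_or_pos n with rfl | hn
  · simp
  obtain ⟨c, rfl⟩ := Nat.exists_eq_add_of_le' ha
  obtain ⟨p, hp⟩ : ∃ p, (c + 2) * n = p + 2 := Nat.exists_eq_add_of_le' (by nlinarith)
  have hcop : (p + 1).Coprime ((c + 1) * (p + 1) + (c + 2)) := by
    rw [Nat.coprime_mul_right_add_right]
    exact Nat.Coprime.coprime_dvd_right (Dvd.intro n hp)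
      (Nat.coprime_self_add_right.mpr (Nat.coprime_one_right _))
  have hm : (((c + 3 : ℕ) : ℤ) - 1) * n - 1 = ((p + 1 : ℕ) : ℤ) := by
    have : ((c : ℤ) + 2) * n = p + 2 := by exact_mod_cast hp
    push_cast
    linarith
  have h1 : (c + 3 - 1) ^ 2 * n - 1 = (c + 1) * (p + 1) + (c + 2) + p := by
    rw [show c + 3 - 1 = c + 2 from rfl, pow_two, mul_assoc, hp]
    exact Nat.sub_eq_of_eq_add (by ring)
  have h2 : (c + 3) * (c + 3 - 1) * n - 2 = (c + 1) * (p + 1) + (c + 2) + (2 * p + 1) := by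
    rw [show c + 3 - 1 = c + 2 from rfl, mul_assoc, hp]
    exact Nat.sub_eq_of_eq_add (by ring)
  have h3 : (c + 3 - 1) * n - 2 = p := by
    rw [show c + 3 - 1 = c + 2 from rfl, hp, Nat.add_sub_cancel]
  have h4 : 2 * (c + 3 - 1) * n - 3 = 2 * p + 1 := by
    rw [show c + 3 - 1 = c + 2 from rfl, mul_assoc, hp]
    rfl
  rw [hm, h1, h2, h3, h4, Int.natCast_dvd_natCast]
  refine Nat.dvd_gcd (dvd_choose_of_coprime_sub dvd_rfl ?_)
    (dvd_choose_of_coprime_sub ⟨2, by ring⟩ ?_)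
  all_goals rwa [Nat.add_sub_cancel]
end

section
/- Let a be a positive integer and b, m, n nonnegative integers with m ≤ n. If A(b,a;n,m) ∈ ℤ[q] and gcd(a,b) = 1, then a divides the binomial coefficient C(n,m). -/
open Polynomial Finset

theorem prod_one_sub_X_pow_eq (n : ℕ) :
    (∏ i ∈ range n, (1 - X ^ (i + 1)) : Polynomial ℤ) =
      (1 - X) ^ n * ∏ i ∈ range n, ∑ j ∈ range (i + 1), X ^ j := by
  simp_rw [← mul_neg_geom_sum (X : Polynomial ℤ), prod_mul_distrib, prod_const, card_range]

theorem eval_one_prod_geom_sum (n : ℕ) :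
    (∏ i ∈ range n, ∑ j ∈ range (i + 1), X ^ j : Polynomial ℤ).eval 1 = (n.factorial : ℤ) := by
  simp [eval_prod, eval_finsetSum, ← prod_range_add_one_eq_factorial]

/-- Cancelling the powers of `1 - q` and setting `q = 1`. -/
theorem AIsPoly.dvd_mul_choose {a b m n : ℕ} (hmn : m ≤ n) (hA : AIsPoly b a n m) :
    a ∣ b * n.choose m := by
  have hX : (1 - X : Polynomial ℤ) ^ (n + 1) ≠ 0 :=
    pow_ne_zero _ (sub_ne_zero.mpr (by simpa using (X_ne_C (1 : ℤ)).symm))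
  let P : ℕ → Polynomial ℤ := fun k => ∏ i ∈ range k, ∑ j ∈ range (i + 1), X ^ j
  let S : ℕ → Polynomial ℤ := fun k => ∑ j ∈ range k, X ^ j
  have hdvd : S a * P m * P (n - m) ∣ S b * P n := by
    refine (mul_dvd_mul_iff_left hX).mp ?_
    unfold AIsPoly at hA
    simp only [prod_one_sub_X_pow_eq] at hA
    rw [← mul_neg_geom_sum X a, ← mul_neg_geom_sum X b] at hA
    convert hA using 1
    · rw [show n + 1 = 1 + m + (n - m) by omega]
      simp only [S, P]
      ring
    · simp only [S, P]
      ring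
  have heval := eval_dvd (x := 1) hdvd
  simp only [eval_mul, P, S, eval_one_prod_geom_sum, eval_geom_sum] at heval
  simp only [one_pow, sum_const, card_range, nsmul_eq_mul, mul_one] at heval
  norm_cast at heval
  rw [← Nat.choose_mul_factorial_mul_factorial hmn, mul_assoc, mul_assoc, ← mul_assoc b] at heval
  exact (Nat.mul_dvd_mul_iff_right (by positivity)).mp heval


theorem stmt9 (a b m n : ℕ) (ha : 0 < a) (hmn : m ≤ n)
    (hA : AIsPoly b a n m) (hgcd : Nat.gcd a b = 1) :
    a ∣ Nat.choose n m := by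
  exact Nat.Coprime.dvd_of_dvd_mul_left hgcd (hA.dvd_mul_choose hmn)
end

section
/- If a and n are nonnegative integers with a ≥ 3 and n ≥ 1, then n + 1 divides (an + 1) · gcd( C((a−1)n − 1, n), C(an, 2n + 1) ), where C(x,y) denotes the binomial coefficient 'x choose y'. -/
theorem dvd_mul_choose {d c k M : ℕ} (hk : d ∣ k + 1) (hc : c = M - k + 2 * d) :
    d ∣ c * Nat.choose M k := by
  have h := Nat.choose_succ_right_eq M k
  rw [hc, add_mul]
  refine dvd_add ?_ (Dvd.dvd.mul_right (dvd_mul_left d 2) _)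
  rw [mul_comm, ← h]
  exact hk.mul_left _

theorem stmt10 (a n : ℕ) (ha : 3 ≤ a) (hn : 1 ≤ n) :
    (n + 1) ∣
      (a * n + 1) *
        Nat.gcd (Nat.choose ((a - 1) * n - 1) n) (Nat.choose (a * n) (2 * n + 1)) := by
  have hle : 3 * n ≤ a * n := Nat.mul_le_mul_right n ha
  rw [← Nat.gcd_mul_left, Nat.sub_one_mul]
  refine Nat.dvd_gcd (dvd_mul_choose dvd_rfl ?_) (dvd_mul_choose ⟨2, by ring⟩ ?_) <;> omega
end

section
/- If a and n are nonnegative integers with a ≥ 3 and n ≥ 2, then n − 1 divides (an − 1) · gcd( C((a−1)n − 1, n − 2), C(an − 2, 2n − 3) ), where C(x,y) denotes the binomial coefficient 'x choose y'. -/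
theorem Nat.dvd_sub_mul_choose {m N k : ℕ} (h : m ∣ k + 1) : m ∣ (N - k) * N.choose k := by
  rw [mul_comm, ← Nat.choose_succ_right_eq]
  exact h.mul_left _

theorem stmt11 (a n : ℕ) (ha : 3 ≤ a) (hn : 2 ≤ n) :
    (n - 1) ∣
      (a * n - 1) *
        Nat.gcd (Nat.choose ((a - 1) * n - 1) (n - 2)) (Nat.choose (a * n - 2) (2 * n - 3)) := by
  obtain ⟨c, rfl⟩ := Nat.exists_eq_add_of_le' ha
  obtain ⟨k, rfl⟩ := Nat.exists_eq_add_of_le' hn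
  have h₁ : (c + 3) * (k + 2) - 1 =
      ((c + 3 - 1) * (k + 2) - 1 - (k + 2 - 2)) + (k + 2 - 1) * 2 := by
    simp only [Nat.add_sub_cancel, show c + 3 - 1 = c + 2 by omega, add_mul, mul_add]
    omega
  have h₂ : (c + 3) * (k + 2) - 1 =
      ((c + 3) * (k + 2) - 2 - (2 * (k + 2) - 3)) + (k + 2 - 1) * 2 := by
    simp only [add_mul, mul_add]
    omega
  rw [← Nat.gcd_mul_left]
  refine Nat.dvd_gcd ?_ ?_
  · rw [h₁, add_mul, mul_assoc]
    exact dvd_add (Nat.dvd_sub_mul_choose (by simp)) (dvd_mul_right _ _)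
  · rw [h₂, add_mul, mul_assoc]
    exact dvd_add (Nat.dvd_sub_mul_choose ⟨2, by omega⟩) (dvd_mul_right _ _)
end
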